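/- Let m ≥ 2 and let B_m be the Artin braid group. Let V : B_m → ℝ[z] be a map into the polynomial ring in one variable z satisfying the Conway skein relation for braids: for all α, β ∈ B_m and every generator index 1 ≤ i ≤ m−1, V(α σ_i β) − V(α σ_i^{-1} β) = z · V(α β). For n ≥ 0 let v_n : B_m → ℝ be the map sending α to the coefficient of z^n in V(α). Then v_n is a finite type (Vassiliev) invariant of braids of degree at most n; that is, for every α₀, α₁, …, α_{n+1} ∈ B_m and every choice of generator indices i₁, …, i_{n+1} ∈ {1, …, m−1}, the alternating sum Σ_{ε ∈ {−1,1}^{n+1}} (ε₁ ⋯ ε_{n+1}) · v_n(α₀ σ_{i₁}^{ε₁} α₁ σ_{i₂}^{ε₂} α₂ ⋯ σ_{i_{n+1}}^{ε_{n+1}} α_{n+1}) = 0. -/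

import Mathlib

open scoped BigOperators

/-- The defining relations of the Artin braid group `B_m` on `m` strings, as elements of the
free group on the generators `σ_1, …, σ_{m-1}` (indexed by `Fin (m-1)`):
`σ_i σ_j σ_i⁻¹ σ_j⁻¹` for `|i - j| ≥ 2` and `σ_i σ_{i+1} σ_i (σ_{i+1} σ_i σ_{i+1})⁻¹`. -/
def braidRels (m : ℕ) : Set (FreeGroup (Fin (m - 1))) :=
  {r | ∃ i j : Fin (m - 1), (i.val + 2 ≤ j.val ∨ j.val + 2 ≤ i.val) ∧
      r = FreeGroup.of i * FreeGroup.of j * (FreeGroup.of j * FreeGroup.of i)⁻¹} ∪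
  {r | ∃ i j : Fin (m - 1), j.val = i.val + 1 ∧
      r = FreeGroup.of i * FreeGroup.of j * FreeGroup.of i *
        (FreeGroup.of j * FreeGroup.of i * FreeGroup.of j)⁻¹}

/-- The Artin braid group `B_m` on `m` strings, presented by generators and relations. -/
def BraidGroup (m : ℕ) : Type := PresentedGroup (braidRels m)

instance (m : ℕ) : Group (BraidGroup m) := by unfold BraidGroup; infer_instance

/-- The Artin generator `σ_i` of the braid group `B_m`. -/
def braidGen (m : ℕ) (i : Fin (m - 1)) : BraidGroup m := PresentedGroup.of i

/-- The braid `α₀ σ_{i₁}^{ε₁} α₁ σ_{i₂}^{ε₂} α₂ ⋯ σ_{i_s}^{ε_s} α_s`, i.e. a full resolution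
(with signs `ε`) of the singular braid with `s` singular points at positions `i₁, …, i_s`
separated by the braids `α₀, …, α_s`. -/
def braidWord {m : ℕ} (s : ℕ) (α : Fin (s + 1) → BraidGroup m)
    (idx : Fin s → Fin (m - 1)) (ε : Fin s → ℤˣ) : BraidGroup m :=
  ((List.finRange s).map fun k =>
    α k.castSucc * braidGen m (idx k) ^ ((ε k : ℤ))).prod * α (Fin.last s)

theorem braidWord_succ_cons {m : ℕ} (s : ℕ) (α : Fin (s + 1 + 1) → BraidGroup m)
    (idx : Fin (s + 1) → Fin (m - 1)) (e : ℤˣ) (ε : Fin s → ℤˣ) :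
    braidWord (s + 1) α idx (Fin.cons e ε : Fin (s + 1) → ℤˣ) =
      α 0 * braidGen m (idx 0) ^ (e : ℤ) *
        braidWord s (fun k => α k.succ) (fun k => idx k.succ) ε := by
  simp [braidWord, List.finRange_succ, List.map_map, Function.comp_def, mul_assoc]

theorem X_pow_dvd_alternating (m : ℕ)
    (V : BraidGroup m → Polynomial ℝ)
    (hskein : ∀ (α β : BraidGroup m) (i : Fin (m - 1)),
      V (α * braidGen m i * β) - V (α * (braidGen m i)⁻¹ * β) =
        Polynomial.X * V (α * β)) (s : ℕ) :
    ∀ (γ : BraidGroup m) (α : Fin (s + 1) → BraidGroup m) (idx : Fin s → Fin (m - 1)),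
      (Polynomial.X : Polynomial ℝ) ^ s ∣ ∑ ε : Fin s → ℤˣ,
        Polynomial.C (∏ k : Fin s, ((ε k : ℤ) : ℝ)) * V (γ * braidWord s α idx ε) := by
  induction s with
  | zero => intro γ α idx; simp
  | succ s ih =>
    intro γ α idx
    have key : ∑ ε : Fin (s + 1) → ℤˣ,
        Polynomial.C (∏ k : Fin (s + 1), ((ε k : ℤ) : ℝ)) * V (γ * braidWord (s + 1) α idx ε) =
        Polynomial.X * ∑ ε : Fin s → ℤˣ, Polynomial.C (∏ k : Fin s, ((ε k : ℤ) : ℝ)) *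
          V (γ * α 0 * braidWord s (fun k => α k.succ) (fun k => idx k.succ) ε) := by
      rw [← (Fin.consEquiv (fun _ : Fin (s + 1) => ℤˣ)).sum_comp, Fintype.sum_prod_type,
        Finset.sum_comm, Finset.mul_sum]
      refine Finset.sum_congr rfl fun ε _ => ?_
      have hu : (Finset.univ : Finset ℤˣ) = {1, -1} := rfl
      have hne : (1 : ℤˣ) ∉ ({-1} : Finset ℤˣ) := by decide
      have h := hskein (γ * α 0)
        (braidWord s (fun k => α k.succ) (fun k => idx k.succ) ε) (idx 0)
      rw [hu, Finset.sum_insert hne, Finset.sum_singleton, mul_left_comm, ← h]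
      have hc : ∀ e : ℤˣ, (Fin.consEquiv (fun _ : Fin (s + 1) => ℤˣ)) (e, ε) =
          (Fin.cons e ε : Fin (s + 1) → ℤˣ) := fun _ => rfl
      simp only [hc, braidWord_succ_cons, Fin.prod_univ_succ, Fin.cons_zero,
        Fin.cons_succ]
      simp [mul_assoc]
      ring
    rw [key, pow_succ']
    exact mul_dvd_mul_left _ (ih _ _ _)

/-- If `V : B_m → ℝ[z]` satisfies the Conway skein relation for braids,
`V(α σ_i β) − V(α σ_i⁻¹ β) = z · V(α β)`, then for every `n` the coefficient of `z^n` in `V`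
is a finite type (Vassiliev) invariant of braids of degree at most `n`: every fully resolved
alternating sum over `n + 1` singular crossings vanishes. -/
theorem coeff_of_conway_skein_is_finite_type (m : ℕ) (hm : 2 ≤ m)
    (V : BraidGroup m → Polynomial ℝ)
    (hskein : ∀ (α β : BraidGroup m) (i : Fin (m - 1)),
      V (α * braidGen m i * β) - V (α * (braidGen m i)⁻¹ * β) =
        Polynomial.X * V (α * β))
    (n : ℕ) :
    ∀ (α : Fin (n + 1 + 1) → BraidGroup m) (idx : Fin (n + 1) → Fin (m - 1)),
      ∑ ε : Fin (n + 1) → ℤˣ,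
        (∏ k : Fin (n + 1), ((ε k : ℤ) : ℝ)) *
          (V (braidWord (n + 1) α idx ε)).coeff n = 0 := by
  intro α idx
  have h := X_pow_dvd_alternating m V hskein (n + 1) 1 α idx
  rw [Polynomial.X_pow_dvd_iff] at h
  have h' := h n (Nat.lt_succ_self n)
  simpa only [Polynomial.finsetSum_coeff, Polynomial.coeff_C_mul, one_mul] using h'
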